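/- Let T ∈ B(H) be self-adjoint with orthogonal decomposition H = ker T ⊕ ker(T − I) ⊕ ker(T − 2I) ⊕ H₀, where H₀ is the orthogonal complement of the sum of the three kernels (H₀ reduces T). Suppose H₀ = K ⊕ K and T restricted to H₀ equals (B ⊕ (−B)) + I for a positive operator B on K with 0 < B < I. Then the pairs (P, Q) of orthogonal projections on H with T = P + Q are exactly the pairs P = 0 ⊕ E ⊕ I ⊕ P_U and Q = 0 ⊕ (I − E) ⊕ I ⊕ Q_U (blocks relative to the above decomposition), where E ranges over all orthogonal projections on ker(T − I) and U ranges over the unitaries in B(K) commuting with B. -/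

import Mathlib

set_option synthInstance.maxHeartbeats 400000
set_option maxHeartbeats 1000000

noncomputable section

/-- `P` is an orthogonal projection: self-adjoint and idempotent. -/
def IsOrthoProj {H : Type*} [NormedAddCommGroup H] [InnerProductSpace ℂ H] [CompleteSpace H]
    (P : H →L[ℂ] H) : Prop :=
  IsSelfAdjoint P ∧ P * P = P

/-- Strict operator inequality `A < B`: `B − A` is positive and injective. -/
def OpLt {H : Type*} [NormedAddCommGroup H] [InnerProductSpace ℂ H] [CompleteSpace H]
    (A B : H →L[ℂ] H) : Prop :=
  (B - A).IsPositive ∧ Function.Injective (B - A)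

/-- The block operator `[[A, B], [C, D]]` on the Hilbert space direct sum `K ⊕₂ K`. -/
def blk {K : Type*} [NormedAddCommGroup K] [InnerProductSpace ℂ K]
    (A B C D : K →L[ℂ] K) : WithLp 2 (K × K) →L[ℂ] WithLp 2 (K × K) :=
  ((WithLp.prodContinuousLinearEquiv 2 ℂ K K).symm : K × K →L[ℂ] WithLp 2 (K × K)) ∘L
    ((A.coprod B).prod (C.coprod D)) ∘L
    ((WithLp.prodContinuousLinearEquiv 2 ℂ K K) : WithLp 2 (K × K) →L[ℂ] K × K)

/-- Block-diagonal operator `A ⊕ C` on the Hilbert space direct sum `E ⊕₂ F`. -/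
def dsum {E F : Type*} [NormedAddCommGroup E] [InnerProductSpace ℂ E]
    [NormedAddCommGroup F] [InnerProductSpace ℂ F]
    (A : E →L[ℂ] E) (C : F →L[ℂ] F) : WithLp 2 (E × F) →L[ℂ] WithLp 2 (E × F) :=
  ((WithLp.prodContinuousLinearEquiv 2 ℂ E F).symm : E × F →L[ℂ] WithLp 2 (E × F)) ∘L
    (A.prodMap C) ∘L
    ((WithLp.prodContinuousLinearEquiv 2 ℂ E F) : WithLp 2 (E × F) →L[ℂ] E × F)

variable {K : Type*} [NormedAddCommGroup K] [InnerProductSpace ℂ K] [CompleteSpace K]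

/-- The projection `P_U = (1/2)·[[I + B, (I − B²)^{1/2}U], [U*(I − B²)^{1/2}, I − B]]`. -/
def PU1 (B U : K →L[ℂ] K) : WithLp 2 (K × K) →L[ℂ] WithLp 2 (K × K) :=
  (((2 : ℝ)⁻¹ : ℝ) : ℂ) •
    blk (1 + B) (CFC.sqrt (1 - B ^ 2) * U) (star U * CFC.sqrt (1 - B ^ 2)) (1 - B)

/-- The projection `Q_U = (1/2)·[[I + B, −(I − B²)^{1/2}U], [−U*(I − B²)^{1/2}, I − B]]`. -/
def QU1 (B U : K →L[ℂ] K) : WithLp 2 (K × K) →L[ℂ] WithLp 2 (K × K) :=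
  (((2 : ℝ)⁻¹ : ℝ) : ℂ) •
    blk (1 + B) (-(CFC.sqrt (1 - B ^ 2) * U)) (-(star U * CFC.sqrt (1 - B ^ 2))) (1 - B)

lemma withLp_prod_ext {E F : Type*} {x y : WithLp 2 (E × F)} (h₁ : x.fst = y.fst)
    (h₂ : x.snd = y.snd) : x = y :=
  WithLp.ofLp_injective 2 (Prod.ext h₁ h₂)

lemma toLp_fst_add_toLp_snd {E F : Type*} [AddCommGroup E] [AddCommGroup F]
    (x : WithLp 2 (E × F)) :
    WithLp.toLp 2 (x.fst, 0) + WithLp.toLp 2 (0, x.snd) = x :=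
  withLp_prod_ext (add_zero _) (zero_add _)

section Dsum

variable {E F : Type*} [NormedAddCommGroup E] [InnerProductSpace ℂ E]
  [NormedAddCommGroup F] [InnerProductSpace ℂ F]

lemma dsum_apply (A : E →L[ℂ] E) (C : F →L[ℂ] F) (x : WithLp 2 (E × F)) :
    dsum A C x = WithLp.toLp 2 (A x.fst, C x.snd) := rfl

lemma dsum_add (A A' : E →L[ℂ] E) (C C' : F →L[ℂ] F) :
    dsum A C + dsum A' C' = dsum (A + A') (C + C') := rfl

lemma dsum_sub (A A' : E →L[ℂ] E) (C C' : F →L[ℂ] F) :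
    dsum A C - dsum A' C' = dsum (A - A') (C - C') := rfl

lemma dsum_mul (A A' : E →L[ℂ] E) (C C' : F →L[ℂ] F) :
    dsum A C * dsum A' C' = dsum (A * A') (C * C') := rfl

lemma dsum_inj {A A' : E →L[ℂ] E} {C C' : F →L[ℂ] F} :
    dsum A C = dsum A' C' ↔ A = A' ∧ C = C' := by
  refine ⟨fun h => ⟨?_, ?_⟩, by rintro ⟨rfl, rfl⟩; rfl⟩
  · ext e
    exact congrArg WithLp.fst (DFunLike.congr_fun h (WithLp.toLp 2 (e, 0)))
  · ext f
    exact congrArg WithLp.snd (DFunLike.congr_fun h (WithLp.toLp 2 (0, f)))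

variable [CompleteSpace E] [CompleteSpace F]

lemma star_dsum (A : E →L[ℂ] E) (C : F →L[ℂ] F) :
    star (dsum A C) = dsum (star A) (star C) := by
  rw [ContinuousLinearMap.star_eq_adjoint (dsum A C), eq_comm, ContinuousLinearMap.eq_adjoint_iff]
  intro x y
  simp [dsum_apply, WithLp.prod_inner_apply, ContinuousLinearMap.star_eq_adjoint,
    ContinuousLinearMap.adjoint_inner_left]

lemma isOrthoProj_dsum {A : E →L[ℂ] E} {C : F →L[ℂ] F} :
    IsOrthoProj (dsum A C) ↔ IsOrthoProj A ∧ IsOrthoProj C := by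
  simp only [IsOrthoProj, IsSelfAdjoint, star_dsum, dsum_mul, dsum_inj]
  tauto

/-- A self-adjoint operator leaving the first summand invariant is block diagonal. -/
lemma exists_eq_dsum {P : WithLp 2 (E × F) →L[ℂ] WithLp 2 (E × F)} (hP : IsSelfAdjoint P)
    (h : ∀ e : E, (P (WithLp.toLp 2 (e, 0))).snd = 0) :
    ∃ (p : E →L[ℂ] E) (p' : F →L[ℂ] F), P = dsum p p' := by
  let L := WithLp.prodContinuousLinearEquiv 2 ℂ E F
  let P' : E × F →L[ℂ] E × F := (L : WithLp 2 (E × F) →L[ℂ] E × F) ∘L P ∘L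
    (L.symm : E × F →L[ℂ] WithLp 2 (E × F))
  have h' (f : F) : (P (WithLp.toLp 2 (0, f))).fst = 0 := by
    rw [← inner_self_eq_zero (𝕜 := ℂ)]
    set e := (P (WithLp.toLp 2 (0, f))).fst
    have := (ContinuousLinearMap.isSelfAdjoint_iff_isSymmetric.mp hP)
      (WithLp.toLp 2 (e, 0)) (WithLp.toLp 2 (0, f))
    simpa [WithLp.prod_inner_apply, h, e] using this.symm
  refine ⟨ContinuousLinearMap.fst ℂ E F ∘L P' ∘L ContinuousLinearMap.inl ℂ E F,
    ContinuousLinearMap.snd ℂ E F ∘L P' ∘L ContinuousLinearMap.inr ℂ E F, ?_⟩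
  refine ContinuousLinearMap.ext fun x => ?_
  conv_lhs => rw [← toLp_fst_add_toLp_snd x, map_add]
  refine withLp_prod_ext ?_ ?_
  · rw [WithLp.add_fst, h', add_zero]
    rfl
  · rw [WithLp.add_snd, h, zero_add]
    rfl

lemma exists_eq_dsum_of_add_eq_dsum {P Q : WithLp 2 (E × F) →L[ℂ] WithLp 2 (E × F)}
    {s : E →L[ℂ] E} {t : F →L[ℂ] F} (hP : IsOrthoProj P) (hQ : IsOrthoProj Q)
    (hPQ : P + Q = dsum s t) (h : ∀ e : E, (P (WithLp.toLp 2 (e, 0))).snd = 0) :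
    ∃ (p q : E →L[ℂ] E) (p' q' : F →L[ℂ] F), P = dsum p p' ∧ Q = dsum q q' ∧
      IsOrthoProj p ∧ IsOrthoProj q ∧ IsOrthoProj p' ∧ IsOrthoProj q' ∧
      p + q = s ∧ p' + q' = t := by
  obtain ⟨p, p', rfl⟩ := exists_eq_dsum hP.1 h
  obtain rfl : Q = dsum (s - p) (t - p') := by
    rw [← dsum_sub, ← hPQ, add_sub_cancel_left]
  rw [isOrthoProj_dsum] at hP hQ
  exact ⟨p, s - p, p', t - p', rfl, rfl, hP.1, hQ.1, hP.2, hQ.2, by abel, by abel⟩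

end Dsum

section OrthoProj

variable {E : Type*} [NormedAddCommGroup E] [InnerProductSpace ℂ E] [CompleteSpace E]
  {P Q : E →L[ℂ] E}

lemma isOrthoProj_zero : IsOrthoProj (0 : E →L[ℂ] E) := ⟨.zero _, by simp⟩

lemma isOrthoProj_one : IsOrthoProj (1 : E →L[ℂ] E) := ⟨.one _, by simp⟩

lemma IsOrthoProj.one_sub (hP : IsOrthoProj P) : IsOrthoProj (1 - P) :=
  ⟨(IsSelfAdjoint.one _).sub hP.1, IsIdempotentElem.one_sub hP.2⟩

lemma IsOrthoProj.inner_apply_self (hP : IsOrthoProj P) (x : E) :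
    inner ℂ (P x) x = (‖P x‖ : ℂ) ^ 2 := by
  have h := (ContinuousLinearMap.isSelfAdjoint_iff_isSymmetric.mp hP.1) (P x) x
  have h2 : P (P x) = P x := DFunLike.congr_fun hP.2 x
  simp only [ContinuousLinearMap.coe_coe, h2] at h
  rw [h, inner_self_eq_norm_sq_to_K]
  rfl

lemma IsOrthoProj.apply_eq_zero_of_add (hP : IsOrthoProj P) (hQ : IsOrthoProj Q) {x : E}
    (h : P x + Q x = 0) : P x = 0 := by
  have h1 : inner ℂ (P x + Q x) x = 0 := by rw [h, inner_zero_left]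
  rw [inner_add_left, hP.inner_apply_self, hQ.inner_apply_self] at h1
  have h2 : ‖P x‖ ^ 2 + ‖Q x‖ ^ 2 = 0 := by exact_mod_cast h1
  rw [← norm_eq_zero]
  nlinarith [sq_nonneg ‖P x‖, sq_nonneg ‖Q x‖]

lemma IsOrthoProj.apply_eq_self_of_add (hP : IsOrthoProj P) (hQ : IsOrthoProj Q) {x : E}
    (h : P x + Q x = (2 : ℂ) • x) : P x = x := by
  have := hP.one_sub.apply_eq_zero_of_add hQ.one_sub (x := x) (by
    simp only [sub_apply, one_apply_eq_self]
    rw [sub_add_sub_comm, h, two_smul, sub_self])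
  exact (sub_eq_zero.mp this).symm

lemma IsOrthoProj.add_apply_apply (hP : IsOrthoProj P) (hQ : IsOrthoProj Q) {x : E}
    (h : P x + Q x = x) : P (P x) + Q (P x) = P x := by
  have hPP : P (P x) = P x := DFunLike.congr_fun hP.2 x
  have hQQ : Q (Q x) = Q x := DFunLike.congr_fun hQ.2 x
  have : Q (P x) + Q (Q x) = Q x := by rw [← map_add, h]
  rw [hQQ, add_eq_right] at this
  rw [hPP, this, add_zero]

end OrthoProj

section Blk

variable {V : Type*} [NormedAddCommGroup V] [InnerProductSpace ℂ V]
  {A B C D A' B' C' D' : V →L[ℂ] V}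

lemma blk_apply (A B C D : V →L[ℂ] V) (x : WithLp 2 (V × V)) :
    blk A B C D x = WithLp.toLp 2 (A x.fst + B x.snd, C x.fst + D x.snd) := rfl

lemma blk_add : blk A B C D + blk A' B' C' D' = blk (A + A') (B + B') (C + C') (D + D') :=
  ContinuousLinearMap.ext fun x => by
    refine withLp_prod_ext ?_ ?_ <;> simp [blk_apply] <;> abel

lemma blk_sub : blk A B C D - blk A' B' C' D' = blk (A - A') (B - B') (C - C') (D - D') :=
  ContinuousLinearMap.ext fun x => by
    refine withLp_prod_ext ?_ ?_ <;> simp [blk_apply] <;> abel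

lemma blk_smul (c : ℂ) : c • blk A B C D = blk (c • A) (c • B) (c • C) (c • D) :=
  ContinuousLinearMap.ext fun x => by
    refine withLp_prod_ext ?_ ?_ <;> simp [blk_apply]

lemma blk_mul : blk A B C D * blk A' B' C' D' =
    blk (A * A' + B * C') (A * B' + B * D') (C * A' + D * C') (C * B' + D * D') :=
  ContinuousLinearMap.ext fun x => by
    refine withLp_prod_ext ?_ ?_ <;> simp [blk_apply] <;> abel

lemma blk_one : blk (1 : V →L[ℂ] V) 0 0 1 = 1 :=
  ContinuousLinearMap.ext fun x => by
    refine withLp_prod_ext ?_ ?_ <;> simp [blk_apply]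

lemma blk_inj : blk A B C D = blk A' B' C' D' ↔ A = A' ∧ B = B' ∧ C = C' ∧ D = D' := by
  refine ⟨fun h => ?_, by rintro ⟨rfl, rfl, rfl, rfl⟩; rfl⟩
  have h1 (k : V) := DFunLike.congr_fun h (WithLp.toLp 2 (k, 0))
  have h2 (k : V) := DFunLike.congr_fun h (WithLp.toLp 2 (0, k))
  simp [blk_apply] at h1 h2
  exact ⟨ContinuousLinearMap.ext fun k => (h1 k).1, ContinuousLinearMap.ext fun k => (h2 k).1,
    ContinuousLinearMap.ext fun k => (h1 k).2, ContinuousLinearMap.ext fun k => (h2 k).2⟩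

lemma exists_eq_blk (P : WithLp 2 (V × V) →L[ℂ] WithLp 2 (V × V)) :
    ∃ A B C D : V →L[ℂ] V, P = blk A B C D := by
  let L := WithLp.prodContinuousLinearEquiv 2 ℂ V V
  let P' : V × V →L[ℂ] V × V := (L : WithLp 2 (V × V) →L[ℂ] V × V) ∘L P ∘L
    (L.symm : V × V →L[ℂ] WithLp 2 (V × V))
  refine ⟨ContinuousLinearMap.fst ℂ V V ∘L P' ∘L ContinuousLinearMap.inl ℂ V V,
    ContinuousLinearMap.fst ℂ V V ∘L P' ∘L ContinuousLinearMap.inr ℂ V V,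
    ContinuousLinearMap.snd ℂ V V ∘L P' ∘L ContinuousLinearMap.inl ℂ V V,
    ContinuousLinearMap.snd ℂ V V ∘L P' ∘L ContinuousLinearMap.inr ℂ V V, ?_⟩
  refine ContinuousLinearMap.ext fun x => ?_
  conv_lhs => rw [← toLp_fst_add_toLp_snd x, map_add]
  rfl

lemma star_blk [CompleteSpace V] : star (blk A B C D) = blk (star A) (star C) (star B) (star D) := by
  rw [ContinuousLinearMap.star_eq_adjoint (blk A B C D), eq_comm, ContinuousLinearMap.eq_adjoint_iff]
  intro x y
  simp only [blk_apply, WithLp.prod_inner_apply, ContinuousLinearMap.star_eq_adjoint,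
    ContinuousLinearMap.adjoint_inner_left, inner_add_left, inner_add_right,
    WithLp.ofLp_fst, WithLp.ofLp_snd]
  ring

end Blk

section Polar

lemma mul_left_cancel_of_injective {V : Type*} [NormedAddCommGroup V] [InnerProductSpace ℂ V]
    {S X Y : V →L[ℂ] V} (hS : Function.Injective S)
    (h : S * X = S * Y) : X = Y :=
  ContinuousLinearMap.ext fun k => hS (DFunLike.congr_fun h k)

lemma mul_right_cancel_of_injective {S X Y : K →L[ℂ] K} (hSA : IsSelfAdjoint S)
    (hS : Function.Injective S) (h : X * S = Y * S) : X = Y := by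
  refine star_injective (mul_left_cancel_of_injective hS ?_)
  simpa [hSA.star_eq] using congrArg star h

/-- Polar decomposition of a normal operator `b` with injective modulus `S`. -/
lemma exists_unitary_of_normal {b S : K →L[ℂ] K} (hSA : IsSelfAdjoint S)
    (hS : Function.Injective S) (h1 : star b * b = S * S) (h2 : b * star b = S * S)
    (hc : Commute b S) : ∃ U ∈ unitary (K →L[ℂ] K), S * U = b ∧ U * S = b := by
  have hnorm (x : K) : ‖b x‖ = ‖S x‖ := by
    have key (V : K →L[ℂ] K) : (‖V x‖ : ℂ) ^ 2 = inner ℂ ((star V * V) x) x := by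
      rw [mul_apply_eq_comp, ContinuousLinearMap.star_eq_adjoint,
        ContinuousLinearMap.adjoint_inner_left, inner_self_eq_norm_sq_to_K]
      rfl
    have h : (‖b x‖ : ℂ) ^ 2 = (‖S x‖ : ℂ) ^ 2 := by
      rw [key, key, h1, hSA.star_eq]
    have h' : ‖b x‖ ^ 2 = ‖S x‖ ^ 2 := by exact_mod_cast h
    exact (sq_eq_sq₀ (norm_nonneg _) (norm_nonneg _)).mp h'
  have hd : DenseRange (S : K →ₗ[ℂ] K) := by
    have : S.range.topologicalClosure = ⊤ := by
      rw [Submodule.topologicalClosure_eq_top_iff, ContinuousLinearMap.orthogonal_range,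
        hSA.adjoint_eq]
      exact LinearMap.ker_eq_bot.mpr hS
    exact (Submodule.dense_iff_topologicalClosure_eq_top.mpr this)
  let U : K →L[ℂ] K := (b : K →ₗ[ℂ] K).extendOfNorm (S : K →ₗ[ℂ] K)
  have hUS : U * S = b := ContinuousLinearMap.ext fun x =>
    LinearMap.extendOfNorm_eq hd ⟨1, fun y => by simpa using (hnorm y).le⟩ x
  have hSU : S * U = b := by
    refine mul_right_cancel_of_injective hSA hS ?_
    rw [mul_assoc, hUS, hc.eq]
  have hUS' : S * star U = star b := by rw [← hUS, star_mul, hSA.star_eq]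
  have hSU' : star U * S = star b := by rw [← hSU, star_mul, hSA.star_eq]
  refine ⟨U, Unitary.mem_iff.mpr ⟨?_, ?_⟩, hSU, hUS⟩
  · refine mul_right_cancel_of_injective hSA hS (mul_left_cancel_of_injective hS ?_)
    rw [mul_assoc, hUS, ← mul_assoc, hUS', h1, one_mul]
  · refine mul_right_cancel_of_injective hSA hS (mul_left_cancel_of_injective hS ?_)
    rw [mul_assoc, hSU', ← mul_assoc, hSU, h2, one_mul]

end Polar

section Halmos

variable {B U : K →L[ℂ] K}

lemma one_sub_sq_nonneg (hB : B.IsPositive) (hB₂ : OpLt B 1) : 0 ≤ 1 - B ^ 2 := by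
  have h0 : 0 ≤ B := (ContinuousLinearMap.nonneg_iff_isPositive B).mpr hB
  have h1 : B ≤ 1 := hB₂.1
  have h2 : 0 ≤ (1 - B) * (1 + B) := by
    refine Commute.mul_nonneg (sub_nonneg.mpr h1) (add_nonneg zero_le_one h0) ?_
    exact ((Commute.one_left _).sub_left ((Commute.one_right _).add_right (.refl B)))
  convert h2 using 1
  noncomm_ring

lemma sqrt_one_sub_sq_mul_self (hB : B.IsPositive) (hB₂ : OpLt B 1) :
    CFC.sqrt (1 - B ^ 2) * CFC.sqrt (1 - B ^ 2) = 1 - B ^ 2 :=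
  CFC.sqrt_mul_sqrt_self _ (one_sub_sq_nonneg hB hB₂)

lemma isSelfAdjoint_sqrt (A : K →L[ℂ] K) : IsSelfAdjoint (CFC.sqrt A) :=
  (CFC.sqrt_nonneg A).isSelfAdjoint

lemma injective_sqrt_one_sub_sq (hB : B.IsPositive) (hB₂ : OpLt B 1) :
    Function.Injective (CFC.sqrt (1 - B ^ 2) : K →L[ℂ] K) := by
  have hinj : Function.Injective (1 + B : K →L[ℂ] K) := by
    refine (injective_iff_map_eq_zero _).mpr fun x hx => ?_
    have hx' : x + B x = 0 := hx
    have h := hB.re_inner_nonneg_left x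
    rw [eq_neg_of_add_eq_zero_right hx', inner_neg_left, map_neg, inner_self_eq_norm_sq] at h
    rw [← norm_eq_zero]
    nlinarith [sq_nonneg ‖x‖]
  have h : Function.Injective ((1 - B) * (1 + B) : K →L[ℂ] K) := hB₂.2.comp hinj
  have h' : (1 - B) * (1 + B) = CFC.sqrt (1 - B ^ 2) * CFC.sqrt (1 - B ^ 2) := by
    rw [sqrt_one_sub_sq_mul_self hB hB₂]
    noncomm_ring
  rw [h'] at h
  exact fun x y hxy => h (congrArg (CFC.sqrt (1 - B ^ 2) : K →L[ℂ] K) hxy)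

lemma commute_sqrt_one_sub_sq {b : K →L[ℂ] K} (h : Commute b B) :
    Commute b (CFC.sqrt (1 - B ^ 2)) :=
  (Commute.cfcₙ_nnreal ((Commute.one_left b).sub_left (h.symm.pow_left 2)) _).symm

lemma eq_zero_of_anticommute (hB : B.IsPositive) (hB₁ : OpLt 0 B) {a : K →L[ℂ] K}
    (h : B * a + a * B = 0) : a = 0 := by
  have h0 : 0 ≤ B := (ContinuousLinearMap.nonneg_iff_isPositive B).mpr hB
  have h1 : B * a = -(a * B) := eq_neg_of_add_eq_zero_left h
  have h2 : Commute (B * B) a := by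
    rw [Commute, SemiconjBy, mul_assoc, h1, mul_neg, ← mul_assoc, h1, neg_mul, neg_neg, mul_assoc]
  have h3 : Commute B a := by
    have := Commute.cfcₙ_nnreal h2 NNReal.sqrt
    rwa [← CFC.sqrt, CFC.sqrt_mul_self B h0] at this
  have h4 : (2 : ℂ) • (B * a) = 0 := by
    rw [two_smul]
    nth_rw 2 [h3.eq]
    exact h
  have hinj : Function.Injective B := by simpa using hB₁.2
  exact mul_left_cancel_of_injective hinj (by simpa using h4)

lemma isOrthoProj_PU1 (hB : B.IsPositive) (hB₂ : OpLt B 1)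
    (hU : U ∈ unitary (K →L[ℂ] K)) (hUB : Commute U B) : IsOrthoProj (PU1 B U) := by
  have hS := isSelfAdjoint_sqrt (1 - B ^ 2)
  have hSS := sqrt_one_sub_sq_mul_self hB hB₂
  have hUS := commute_sqrt_one_sub_sq hUB
  have hBS := commute_sqrt_one_sub_sq (Commute.refl B)
  have hU'B : Commute (star U) B := by
    simpa [hB.isSelfAdjoint.star_eq] using hUB.star_star
  have hU1 := Unitary.star_mul_self_of_mem hU
  have hU2 := Unitary.mul_star_self_of_mem hU
  unfold PU1
  set S := CFC.sqrt (1 - B ^ 2)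
  have e1 : S * U * (star U * S) = 1 - B ^ 2 := by
    rw [mul_assoc, ← mul_assoc U, hU2, one_mul, hSS]
  have e2 : star U * S * (S * U) = 1 - B ^ 2 := by
    rw [← hUS.eq, mul_assoc, ← mul_assoc S, ← hUS.eq, mul_assoc, hSS, ← mul_assoc, hU1, one_mul]
  have e3 : B * (S * U) = S * U * B := by
    rw [← mul_assoc, hBS.eq, mul_assoc, ← hUB.eq, mul_assoc]
  have e4 : B * (star U * S) = star U * S * B := by
    rw [← mul_assoc, ← hU'B.eq, mul_assoc, hBS.eq, mul_assoc]
  refine ⟨?_, ?_⟩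
  · rw [IsSelfAdjoint, star_smul, star_blk]
    simp [hS.star_eq, hB.isSelfAdjoint.star_eq]
  · rw [smul_mul_smul_comm, blk_mul, e1, e2, blk_smul, blk_smul, blk_inj]
    simp only [mul_add, add_mul, mul_sub, sub_mul, mul_one, one_mul, e3, e4]
    refine ⟨?_, ?_, ?_, ?_⟩ <;> push_cast <;> (try rw [pow_two]) <;> module

lemma QU1_eq_PU1_neg : QU1 B U = PU1 B (-U) := by
  simp [QU1, PU1]

lemma PU1_add_QU1 : PU1 B U + QU1 B U = blk B 0 0 (-B) + 1 := by
  rw [PU1, QU1, blk_smul, blk_smul, blk_add, ← blk_one, blk_add, blk_inj]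
  refine ⟨?_, ?_, ?_, ?_⟩ <;> push_cast <;> module

lemma exists_unitary_of_add_eq (hB : B.IsPositive) (hB₁ : OpLt 0 B) (hB₂ : OpLt B 1)
    {P Q : WithLp 2 (K × K) →L[ℂ] WithLp 2 (K × K)} (hP : IsOrthoProj P) (hQ : IsOrthoProj Q)
    (hPQ : P + Q = blk B 0 0 (-B) + 1) :
    ∃ U ∈ unitary (K →L[ℂ] K), Commute U B ∧ P = PU1 B U ∧ Q = QU1 B U := by
  suffices h : ∃ U ∈ unitary (K →L[ℂ] K), Commute U B ∧ P = PU1 B U by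
    obtain ⟨U, hU, hUB, rfl⟩ := h
    exact ⟨U, hU, hUB, rfl, add_left_cancel (hPQ.trans PU1_add_QU1.symm)⟩
  obtain ⟨a, b, c, d, rfl⟩ := exists_eq_blk P
  obtain rfl : Q = blk (B + 1 - a) (-b) (-c) (-B + 1 - d) := by
    rw [eq_sub_of_add_eq' hPQ, ← blk_one, blk_add, blk_sub, blk_inj]
    simp
  obtain ⟨hP1, hP2⟩ := hP
  have hQ2 := hQ.2
  rw [IsSelfAdjoint, star_blk, blk_inj] at hP1
  rw [blk_mul, blk_inj] at hP2 hQ2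
  obtain ⟨-, -, hbc, -⟩ := hP1
  obtain ⟨p1, p2, p3, p4⟩ := hP2
  obtain ⟨q1, q2, q3, q4⟩ := hQ2
  have ha : (2 : ℂ) • a - (1 + B) = 0 := by
    refine eq_zero_of_anticommute hB hB₁ ?_
    linear_combination (norm := skip) (2 : ℂ) • (p1 - q1)
    simp only [mul_add, add_mul, mul_sub, sub_mul, mul_one, one_mul, mul_neg, neg_mul, neg_neg,
      mul_smul_comm, smul_mul_assoc, smul_add, smul_sub]
    module
  have hd : (2 : ℂ) • d - (1 - B) = 0 := by
    refine eq_zero_of_anticommute hB hB₁ ?_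
    linear_combination (norm := skip) (2 : ℂ) • (q4 - p4)
    simp only [mul_add, add_mul, mul_sub, sub_mul, mul_one, one_mul, mul_neg, neg_mul, neg_neg,
      mul_smul_comm, smul_mul_assoc, smul_add, smul_sub, smul_neg]
    module
  have hbB : Commute b B := by
    rw [Commute, SemiconjBy]
    linear_combination (norm := skip) q2 - p2
    simp only [mul_add, add_mul, mul_sub, sub_mul, mul_one, one_mul, mul_neg, neg_mul, neg_neg]
    module
  have ha' : a = (2⁻¹ : ℂ) • (1 + B) := by
    rw [← sub_eq_zero.mp ha]; module
  have hd' : d = (2⁻¹ : ℂ) • (1 - B) := by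
    rw [← sub_eq_zero.mp hd]; module
  have hstar : star ((2 : ℂ) • b) = (2 : ℂ) • c := by simp [hbc]
  have e1 : ((2 : ℂ) • b) * star ((2 : ℂ) • b) = 1 - B ^ 2 := by
    rw [hstar]
    rw [ha'] at p1
    linear_combination (norm := skip) (4 : ℂ) • p1
    simp only [mul_add, add_mul, mul_one, one_mul, mul_smul_comm, smul_mul_assoc, smul_add]
    rw [pow_two]
    module
  have e2 : star ((2 : ℂ) • b) * ((2 : ℂ) • b) = 1 - B ^ 2 := by
    rw [hstar]
    rw [hd'] at p4
    linear_combination (norm := skip) (4 : ℂ) • p4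
    simp only [mul_sub, sub_mul, mul_one, one_mul, mul_smul_comm, smul_mul_assoc, smul_add,
      smul_sub]
    rw [pow_two]
    module
  have hSS := sqrt_one_sub_sq_mul_self hB hB₂
  have hS := isSelfAdjoint_sqrt (1 - B ^ 2)
  have hSi := injective_sqrt_one_sub_sq hB hB₂
  have hBS := commute_sqrt_one_sub_sq (Commute.refl B)
  obtain ⟨U, hU, hSU, hUS⟩ := exists_unitary_of_normal hS hSi (e2.trans hSS.symm)
    (e1.trans hSS.symm) (commute_sqrt_one_sub_sq (hbB.smul_left 2))
  refine ⟨U, hU, ?_, ?_⟩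
  · refine mul_left_cancel_of_injective hSi ?_
    rw [← mul_assoc, hSU, (hbB.smul_left (2 : ℂ)).eq, ← hSU, ← mul_assoc, hBS.eq, mul_assoc]
  · have hS' : star U * CFC.sqrt (1 - B ^ 2) = (2 : ℂ) • c := by
      rw [← hstar, ← hSU, star_mul, hS.star_eq]
    rw [PU1, hS', hSU, blk_smul, blk_inj, ha', hd']
    refine ⟨?_, ?_, ?_, ?_⟩ <;> push_cast <;> module

end Halmos

/-- For `T = 0 ⊕ I ⊕ 2I ⊕ ((B ⊕ (−B)) + I)` relative to
`H = ker T ⊕ ker(T−I) ⊕ ker(T−2I) ⊕ (K ⊕ K)`, with `0 < B < I`, the pairs of projections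
`(P, Q)` with `T = P + Q` are exactly the pairs `(0 ⊕ E ⊕ I ⊕ P_U, 0 ⊕ (I−E) ⊕ I ⊕ Q_U)`
for orthogonal projections `E` on `ker(T−I)` and unitaries `U` commuting with `B`. -/
theorem sum_of_two_projections_full_classification
    {H₀ H₁ H₂ : Type*}
    [NormedAddCommGroup H₀] [InnerProductSpace ℂ H₀] [CompleteSpace H₀]
    [NormedAddCommGroup H₁] [InnerProductSpace ℂ H₁] [CompleteSpace H₁]
    [NormedAddCommGroup H₂] [InnerProductSpace ℂ H₂] [CompleteSpace H₂]
    (B : K →L[ℂ] K) (hBpos : B.IsPositive)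
    (hB₁ : OpLt 0 B) (hB₂ : OpLt B 1)
    (T : WithLp 2 (H₀ × WithLp 2 (H₁ × WithLp 2 (H₂ × WithLp 2 (K × K)))) →L[ℂ]
         WithLp 2 (H₀ × WithLp 2 (H₁ × WithLp 2 (H₂ × WithLp 2 (K × K)))))
    (hT : T = dsum 0 (dsum 1 (dsum ((2 : ℂ) • 1) (blk B 0 0 (-B) + 1)))) :
    ∀ P Q, (IsOrthoProj P ∧ IsOrthoProj Q ∧ T = P + Q) ↔
      (∃ E : H₁ →L[ℂ] H₁, IsOrthoProj E ∧
        ∃ U ∈ unitary (K →L[ℂ] K), Commute U B ∧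
          P = dsum 0 (dsum E (dsum 1 (PU1 B U))) ∧
          Q = dsum 0 (dsum (1 - E) (dsum 1 (QU1 B U)))) := by
  intro P Q
  constructor
  · rintro ⟨hP, hQ, hPQ⟩
    rw [hT] at hPQ
    have hPQ₀ := hPQ.symm
    obtain ⟨p₀, q₀, P₁, Q₁, rfl, rfl, hp₀, hq₀, hP₁, hQ₁, h₀, hPQ₁⟩ :=
      exists_eq_dsum_of_add_eq_dsum hP hQ hPQ₀ fun e => by
        rw [hP.apply_eq_zero_of_add hQ]
        · rfl
        · rw [← add_apply, hPQ₀, dsum_apply]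
          simp
    obtain ⟨E, E', P₂, Q₂, rfl, rfl, hE, hE', hP₂, hQ₂, h₁, hPQ₂⟩ :=
      exists_eq_dsum_of_add_eq_dsum hP₁ hQ₁ hPQ₁ fun e => by
        have h := hP₁.add_apply_apply hQ₁ (x := WithLp.toLp 2 (e, 0)) (by
          rw [← add_apply, hPQ₁, dsum_apply]
          simp)
        rw [← add_apply, hPQ₁] at h
        have h2 := congrArg WithLp.snd h
        set y := (P₁ (WithLp.toLp 2 (e, 0))).snd
        have h3 : dsum ((2 : ℂ) • 1) (blk B 0 0 (-B) + 1) y = y := h2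
        have hinj : Function.Injective B := by simpa using hB₁.2
        have hB0 {k : K} (hk : B k = 0) : k = 0 := hinj (hk.trans (map_zero B).symm)
        have a1 := congrArg WithLp.fst h3
        have a2 := congrArg (fun z => z.snd.fst) h3
        have a3 := congrArg (fun z => z.snd.snd) h3
        simp [dsum_apply, blk_apply, two_smul] at a1 a2 a3
        exact withLp_prod_ext a1 (withLp_prod_ext (hB0 a2) (hB0 a3))
    obtain ⟨p₂, q₂, P₃, Q₃, rfl, rfl, hp₂, hq₂, hP₃, hQ₃, h₂, hPQ₃⟩ :=
      exists_eq_dsum_of_add_eq_dsum hP₂ hQ₂ hPQ₂ fun e => by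
        rw [hP₂.apply_eq_self_of_add hQ₂]
        · rfl
        · rw [← add_apply, hPQ₂, dsum_apply]
          refine withLp_prod_ext ?_ ?_ <;> simp
    obtain ⟨U, hU, hUB, rfl, rfl⟩ := exists_unitary_of_add_eq hBpos hB₁ hB₂ hP₃ hQ₃ hPQ₃
    obtain rfl : p₀ = 0 := ContinuousLinearMap.ext fun x =>
      hp₀.apply_eq_zero_of_add hq₀ (DFunLike.congr_fun h₀ x)
    obtain rfl : p₂ = 1 := ContinuousLinearMap.ext fun x =>
      hp₂.apply_eq_self_of_add hq₂ (DFunLike.congr_fun h₂ x)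
    obtain rfl : q₀ = 0 := by simpa using h₀
    obtain rfl : q₂ = 1 := by simpa [two_smul] using h₂
    obtain rfl : E' = 1 - E := eq_sub_of_add_eq' h₁
    exact ⟨E, hE, U, hU, hUB, rfl, rfl⟩
  · rintro ⟨E, hE, U, hU, hUB, rfl, rfl⟩
    refine ⟨?_, ?_, ?_⟩
    · simp only [isOrthoProj_dsum]
      exact ⟨isOrthoProj_zero, hE, isOrthoProj_one, isOrthoProj_PU1 hBpos hB₂ hU hUB⟩
    · simp only [isOrthoProj_dsum, QU1_eq_PU1_neg]
      exact ⟨isOrthoProj_zero, hE.one_sub, isOrthoProj_one,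
        isOrthoProj_PU1 hBpos hB₂ (by simpa [Unitary.mem_iff] using hU) hUB.neg_left⟩
    · rw [hT, dsum_add, dsum_add, dsum_add, PU1_add_QU1, add_zero, add_sub_cancel, ← two_smul ℂ]
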